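/- Let d ≥ 1, let b_0 = 0 < b_1 < ... < b_d be real numbers, and let p_0, p_1, ..., p_d be real polynomials, not all of them zero. Then the function F(x) = Σ_{i=0}^d p_i(x)·log(x + b_i) has only finitely many zeros in the open interval (0, ∞); that is, the set {x ∈ ℝ : x > 0 and F(x) = 0} is finite. -/

import Mathlib

/-- A set of reals is finite if a finite set separates any two of its points. -/
theorem Set.Finite.of_separated {Z T : Set ℝ} (hT : T.Finite)
    (h : ∀ x ∈ Z, ∀ y ∈ Z, x < y → ∃ t ∈ T, x < t ∧ t < y) : Z.Finite := by
  refine Set.Finite.of_injOn (f := fun x => T ∩ Set.Iio x) (t := 𝒫 T)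
    (fun x _ => Set.inter_subset_left) ?_ hT.finite_subsets
  intro x hx y hy hxy
  have key : ∀ x ∈ Z, ∀ y ∈ Z, x < y → T ∩ Set.Iio x ≠ T ∩ Set.Iio y := by
    intro x hx y hy hlt heq
    obtain ⟨t, ht, hxt, hty⟩ := h x hx y hy hlt
    have : t ∈ T ∩ Set.Iio x := heq ▸ ⟨ht, hty⟩
    exact absurd this.2 (not_lt.2 hxt.le)
  rcases lt_trichotomy x y with hlt | heq | hlt
  · exact absurd hxy (key x hx y hy hlt)
  · exact heq
  · exact absurd hxy.symm (key y hy x hx hlt)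

namespace Polynomial

/-- If the Wronskian of `q` and `r` vanishes at `β` to order at least `2 m - 1`, where `m` is the
order of vanishing of `r` at `β`, then `q` vanishes at `β` to order at least `m`. -/
theorem X_sub_C_pow_dvd_of_dvd_wronskian {q v : ℝ[X]} {β : ℝ} {m : ℕ} (hv : v.eval β ≠ 0)
    (h : (X - C β) ^ (2 * m) ∣ (X - C β) *
      (derivative q * ((X - C β) ^ m * v) - q * derivative ((X - C β) ^ m * v))) :
    (X - C β) ^ m ∣ q := by
  rcases eq_or_ne q 0 with rfl | hq
  · exact dvd_zero _
  obtain ⟨u, hqu, hu⟩ := exists_eq_pow_rootMultiplicity_mul_and_not_dvd q hq β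
  set k := q.rootMultiplicity β
  rw [dvd_iff_isRoot, IsRoot.def] at hu
  have deriv_mul (n : ℕ) (w : ℝ[X]) : (X - C β) * derivative ((X - C β) ^ n * w) =
      (X - C β) ^ n * (C (n : ℝ) * w + (X - C β) * derivative w) := by
    rcases n with _ | n
    · simp
    · simp only [derivative_mul, derivative_X_sub_C_pow, Nat.add_sub_cancel, Nat.cast_add,
        Nat.cast_one, map_add, map_natCast, map_one]
      ring
  have hW : (X - C β) *
      (derivative q * ((X - C β) ^ m * v) - q * derivative ((X - C β) ^ m * v)) =
      (X - C β) ^ (k + m) * (C ((k : ℝ) - m) * (u * v) +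
        (X - C β) * (derivative u * v - u * derivative v)) := by
    have h1 := deriv_mul k u
    have h2 := deriv_mul m v
    rw [← hqu] at h1
    rw [map_sub, mul_sub, ← mul_assoc, h1, mul_left_comm _ q, h2]
    linear_combination -((X - C β) ^ m * (C (m : ℝ) * v + (X - C β) * derivative v)) * hqu
  have hkm : m ≤ k := by
    by_contra! hlt
    rw [hW, show 2 * m = (k + m) + (m - k) by omega, pow_add,
      mul_dvd_mul_iff_left (pow_ne_zero _ (X_sub_C_ne_zero β))] at h
    have h0 := (dvd_pow_self (X - C β) (show m - k ≠ 0 by omega)).trans h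
    rw [dvd_iff_isRoot, IsRoot.def] at h0
    simp only [eval_add, eval_mul, eval_C, eval_sub, eval_X, sub_self, zero_mul, add_zero,
      mul_eq_zero, hu, hv, or_false, sub_eq_zero, Nat.cast_inj] at h0
    omega
  exact (pow_dvd_pow _ hkm).trans ⟨u, hqu⟩

/-- A derivative of a rational function plus logarithmic terms `c i / (X + b i)`, one of them with
residue `1`, does not vanish; here `c i = p i / r`, and denominators have been cleared. -/
theorem wronskian_add_residues_ne_zero {ι : Type*} (s : Finset ι) (p D : ι → ℝ[X])
    {q r P : ℝ[X]} {β : ℝ} (hr : r ≠ 0) (hP : P.eval β ≠ 0)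
    (hp : ∀ i ∈ s, derivative (p i) * r - p i * derivative r = 0) :
    (derivative q * r - q * derivative r) * ((X - C β) * P) +
      (r * ∑ i ∈ s, p i * ((X - C β) * D i) + r * r * P) ≠ 0 := by
  intro h
  obtain ⟨v, hrv, hv⟩ := exists_eq_pow_rootMultiplicity_mul_and_not_dvd r hr β
  set m := r.rootMultiplicity β
  rw [dvd_iff_isRoot, IsRoot.def] at hv
  have hpi : ∀ i ∈ s, (X - C β) ^ m ∣ p i := fun i hi =>
    X_sub_C_pow_dvd_of_dvd_wronskian hv (by rw [← hrv, hp i hi]; simp)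
  have hsum : (X - C β) ^ (m + 1) ∣ ∑ i ∈ s, p i * ((X - C β) * D i) := by
    refine Finset.dvd_sum fun i hi => ?_
    rw [pow_succ]
    exact mul_dvd_mul (hpi i hi) (dvd_mul_right _ _)
  obtain ⟨A, hA⟩ := hsum
  rw [hA] at h
  have hcop : IsCoprime ((X - C β) ^ (2 * m)) P := by
    refine IsCoprime.pow_left ((irreducible_X_sub_C β).coprime_iff_not_dvd.2 ?_)
    rwa [dvd_iff_isRoot, IsRoot.def]
  have hq : (X - C β) ^ m ∣ q := by
    refine X_sub_C_pow_dvd_of_dvd_wronskian hv ?_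
    rw [← hrv]
    refine hcop.dvd_of_dvd_mul_right ⟨-(v * (X - C β) * A + v * v * P), ?_⟩
    have : (X - C β) ^ (2 * m) * -(v * (X - C β) * A + v * v * P) =
        -(((X - C β) ^ m * v) * ((X - C β) ^ (m + 1) * A) +
          ((X - C β) ^ m * v) * ((X - C β) ^ m * v) * P) := by ring
    rw [this, ← hrv]
    linear_combination h
  obtain ⟨w, hw⟩ := hq
  have hW : derivative q * r - q * derivative r =
      (X - C β) ^ (2 * m) * (derivative w * v - w * derivative v) := by
    rw [hw, hrv]
    simp only [derivative_mul]
    ring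
  have h' : (X - C β) ^ (2 * m) * ((derivative w * v - w * derivative v) * ((X - C β) * P) +
      v * ((X - C β) * A) + v * v * P) = 0 := by
    rw [hW, hrv] at h
    linear_combination h
  have h0 := (mul_eq_zero.1 h').resolve_left (pow_ne_zero _ (X_sub_C_ne_zero β))
  simpa [hv, hP] using congrArg (eval β) h0

end Polynomial

open Polynomial in
/-- A nontrivial combination of `1` and the `log (x + b i)` with polynomial coefficients has
finitely many positive zeros. -/
theorem Polynomial.finite_zeros_log_combination {ι : Type*} [DecidableEq ι] (s : Finset ι)
    (b : ι → ℝ) (hb : ∀ i ∈ s, 0 ≤ b i) (hinj : Set.InjOn b s) (p : ι → ℝ[X]) (q : ℝ[X])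
    (hpq : (∃ i ∈ s, p i ≠ 0) ∨ q ≠ 0) :
    {x : ℝ | 0 < x ∧ (∑ i ∈ s, (p i).eval x * Real.log (x + b i)) + q.eval x = 0}.Finite := by
  induction s using Finset.induction_on generalizing p q with
  | empty =>
    have hq : q ≠ 0 := by simpa using hpq
    refine (finite_setOfPred_isRoot hq).subset ?_
    rintro x ⟨-, hx⟩
    simpa using hx
  | insert a s ha ih =>
    have hbs : ∀ i ∈ s, 0 ≤ b i := fun i hi => hb i (Finset.mem_insert_of_mem hi)
    have hba : 0 ≤ b a := hb a (Finset.mem_insert_self a s)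
    replace ih := ih hbs (hinj.mono (by simp))
    by_cases hpa : p a = 0
    · simpa [Finset.sum_insert ha, hpa] using ih p q (by simpa [hpa] using hpq)
    set r := p a with hr
    set P : ℝ[X] := ∏ j ∈ s, (X + C (b j)) with hPdef
    set D : ι → ℝ[X] := fun i => ∏ j ∈ s.erase i, (X + C (b j)) with hDdef
    have hP : P.eval (-b a) ≠ 0 := by
      rw [hPdef, eval_prod, Finset.prod_ne_zero_iff]
      intro j hj h0
      have : b j = b a := by simp at h0; linarith
      exact ha (hinj (by simp [hj]) (by simp) this ▸ hj)
    set L : ℝ[X] := X - C (-b a) with hL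
    have hLP : L * P ≠ 0 := by
      refine mul_ne_zero (X_sub_C_ne_zero _) ?_
      rintro h0
      simp [h0] at hP
    set p' : ι → ℝ[X] := fun i => (derivative (p i) * r - p i * derivative r) * (L * P) with hp'
    set q' : ℝ[X] := (derivative q * r - q * derivative r) * (L * P) +
      (r * ∑ i ∈ s, p i * (L * D i) + r * r * P) with hq'
    have hne : (∃ i ∈ s, p' i ≠ 0) ∨ q' ≠ 0 := by
      by_contra! hcon
      exact wronskian_add_residues_ne_zero s p D hpa hP
        (fun i hi => (mul_eq_zero.1 (hcon.1 i hi)).resolve_right hLP) hcon.2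
    have hfin := (ih p' q' hne).union (finite_setOfPred_isRoot hpa)
    set Z := {x : ℝ | 0 < x ∧
      (∑ i ∈ insert a s, (p i).eval x * Real.log (x + b i)) + q.eval x = 0}
    suffices h : (Z \ {x | IsRoot r x}).Finite from
      (h.union (finite_setOfPred_isRoot hpa)).subset fun x hx => by
        by_cases hx' : IsRoot r x
        · exact Or.inr hx'
        · exact Or.inl ⟨hx, hx'⟩
    refine Set.Finite.of_separated hfin ?_
    rintro x ⟨⟨hx, hfx⟩, hrx⟩ y ⟨⟨hy, hfy⟩, hry⟩ hxy
    by_cases hroot : ∃ t, IsRoot r t ∧ x < t ∧ t < y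
    · obtain ⟨t, ht, h⟩ := hroot
      exact ⟨t, Or.inr ht, h⟩
    push Not at hroot
    have hr0 : ∀ t ∈ Set.Icc x y, r.eval t ≠ 0 := by
      rintro t ⟨hxt, hty⟩ h0
      rcases hxt.eq_or_lt with rfl | hxt
      · exact hrx h0
      rcases hty.eq_or_lt with rfl | hty
      · exact hry h0
      exact absurd hty (not_lt.2 (hroot t h0 hxt))
    set g : ℝ → ℝ := fun t =>
      (∑ i ∈ s, (p i).eval t / r.eval t * Real.log (t + b i)) + q.eval t / r.eval t +
        Real.log (t + b a) with hg
    have hg0 : ∀ t, r.eval t ≠ 0 →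
        (∑ i ∈ insert a s, (p i).eval t * Real.log (t + b i)) + q.eval t = 0 → g t = 0 := by
      intro t ht h0
      have : g t = ((∑ i ∈ insert a s, (p i).eval t * Real.log (t + b i)) + q.eval t) /
          r.eval t := by
        simp only [hg, Finset.sum_insert ha, add_div, Finset.sum_div, ← hr]
        rw [mul_div_cancel_left₀ _ ht]
        simp only [div_mul_eq_mul_div]
        ring
      rw [this, h0, zero_div]
    set g' : ℝ → ℝ := fun t =>
      (∑ i ∈ s, (((derivative (p i)).eval t * r.eval t - (p i).eval t * (derivative r).eval t) /
        r.eval t ^ 2 * Real.log (t + b i) + (p i).eval t / r.eval t * (1 / (t + b i)))) +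
        ((derivative q).eval t * r.eval t - q.eval t * (derivative r).eval t) / r.eval t ^ 2 +
        1 / (t + b a) with hg'
    have hlog : ∀ t : ℝ, 0 < t → ∀ c : ℝ, 0 ≤ c →
        HasDerivAt (fun t => Real.log (t + c)) (1 / (t + c)) t := fun t ht c hc =>
      ((hasDerivAt_id t).add_const c).log (by simp; positivity)
    have hderiv : ∀ t ∈ Set.Icc x y, HasDerivAt g (g' t) t := by
      intro t ht
      have ht0 : 0 < t := hx.trans_le ht.1
      have hdiv (f : ℝ[X]) := (f.hasDerivAt t).div (r.hasDerivAt t) (hr0 t ht)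
      exact ((HasDerivAt.fun_sum fun i hi => (hdiv (p i)).mul (hlog t ht0 _ (hbs i hi))).add
        (hdiv q)).add (hlog t ht0 _ hba)
    obtain ⟨t, ht, hgt⟩ := exists_hasDerivAt_eq_zero hxy
      (fun t ht => (hderiv t ht).continuousAt.continuousWithinAt)
      ((hg0 x hrx hfx).trans (hg0 y hry hfy).symm)
      (fun t ht => hderiv t (Set.Ioo_subset_Icc_self ht))
    have ht0 : 0 < t := hx.trans ht.1
    have hrt := hr0 t (Set.Ioo_subset_Icc_self ht)
    have hta : t + b a ≠ 0 := by positivity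
    refine ⟨t, Or.inl ⟨ht0, ?_⟩, ht⟩
    have hDi : ∀ i ∈ s, (D i).eval t = P.eval t / (t + b i) := by
      intro i hi
      have : t + b i ≠ 0 := (add_pos_of_pos_of_nonneg ht0 (hbs i hi)).ne'
      rw [eq_div_iff this, hPdef, ← Finset.mul_prod_erase s _ hi]
      simp [hDdef, mul_comm]
    have hLt : L.eval t = t + b a := by simp [hL]
    have hmul : (∑ i ∈ s, (p' i).eval t * Real.log (t + b i)) + q'.eval t =
        r.eval t ^ 2 * ((t + b a) * P.eval t) * g' t := by
      simp only [hg', hp', hq', eval_add, eval_mul, eval_sub, eval_finsetSum, hLt, mul_add,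
        Finset.mul_sum]
      rw [← add_assoc, ← add_assoc, add_right_comm (∑ i ∈ s, _), ← Finset.sum_add_distrib]
      congr 1
      · congr 1
        · refine Finset.sum_congr rfl fun i hi => ?_
          rw [hDi i hi]
          field_simp
        · field_simp
      · field_simp
    rw [hmul, hgt, mul_zero]

theorem log_combination_finitely_many_zeros
    (d : ℕ) (hd : 1 ≤ d)
    (b : Fin (d + 1) → ℝ) (hb0 : b 0 = 0) (hb : StrictMono b)
    (p : Fin (d + 1) → Polynomial ℝ) (hp : ∃ i, p i ≠ 0) :
    {x : ℝ | 0 < x ∧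
      (∑ i : Fin (d + 1), (p i).eval x * Real.log (x + b i)) = 0}.Finite := by
  simpa using Polynomial.finite_zeros_log_combination Finset.univ b
    (fun i _ => hb0 ▸ hb.monotone (Fin.zero_le i)) hb.injective.injOn p 0 (by simpa using hp)
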